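/- arXiv:2210.02846 — 5 statements merged into one kernel-verified Lean document; each statement's English description precedes it below -/
import Mathlib

section
/- Let μ = e^{−Φ} L^{2N} × H^N⌞E on Z × Z, where Φ : Z → ℝ is Borel and satisfies the sub-Gaussian transversality condition β₀‖y − z‖² + Φ(y) ≥ c(‖y‖² + ‖z‖²) − b for all y ∈ Z, z ∈ E, with constants β₀, c, b > 0. Then there is a constant C < ∞ such that the thermalizations satisfy μ_β(Z × Z) ≤ C for every β ≥ 2β₀; in particular each μ_β with β ≥ 2β₀ is a finite measure. -/
open MeasureTheory Real Filter Topology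

noncomputable section

/-- Phase space `Z`, identified with `ℝ^{2N}` (with Lebesgue measure `volume`). -/
abbrev ZZ (N : ℕ) := EuclideanSpace ℝ (Fin (2 * N))

/-- The normalization constant `B_β = ∫_Z exp(−β‖ξ‖²) dL^{2N}(ξ)`. -/
def Bconst (N : ℕ) (β : ℝ) : ℝ := ∫ ξ : ZZ N, Real.exp (-β * ‖ξ‖ ^ 2)

/-- The thermalization `μ_β := w_β · μ` with `w_β(y,z) = B_β⁻¹ exp(−β‖y−z‖²)`. -/
def therm {N : ℕ} (μ : Measure (ZZ N × ZZ N)) (β : ℝ) : Measure (ZZ N × ZZ N) :=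
  μ.withDensity fun q => ENNReal.ofReal ((Bconst N β)⁻¹ * Real.exp (-β * ‖q.1 - q.2‖ ^ 2))

/-- The deterministic physical likelihood `μ_E = H^N ⌞ E`. -/
def muE (N : ℕ) (E : AffineSubspace ℝ (ZZ N)) : Measure (ZZ N) :=
  (μH[(N : ℝ)]).restrict (E : Set (ZZ N))

/-- The sub-Gaussian material likelihood `μ_D = e^{−Φ} L^{2N}`. -/
def muD (N : ℕ) (Φ : ZZ N → ℝ) : Measure (ZZ N) :=
  volume.withDensity fun y => ENNReal.ofReal (Real.exp (-Φ y))

theorem integrable_rexp_neg_mul_sq_norm {V : Type*} [NormedAddCommGroup V]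
    [InnerProductSpace ℝ V] [FiniteDimensional ℝ V] [MeasurableSpace V] [BorelSpace V]
    {b : ℝ} (hb : 0 < b) : Integrable fun v : V => Real.exp (-b * ‖v‖ ^ 2) := by
  refine Integrable.of_integral_ne_zero ?_
  rw [GaussianFourier.integral_rexp_neg_mul_sq_norm hb]
  positivity

theorem lintegral_rexp_neg_mul_sq_norm_lt_top {V : Type*} [NormedAddCommGroup V]
    [InnerProductSpace ℝ V] [FiniteDimensional ℝ V] [MeasurableSpace V] [BorelSpace V]
    (μ : Measure V) [μ.IsAddHaarMeasure] {b : ℝ} (hb : 0 < b) :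
    ∫⁻ v : V, ENNReal.ofReal (Real.exp (-b * ‖v‖ ^ 2)) ∂μ < ⊤ := by
  rw [Measure.isAddLeftInvariant_eq_smul μ volume]
  exact ((integrable_rexp_neg_mul_sq_norm hb).smul_measure_nnreal).lintegral_lt_top

theorem Bconst_eq (N : ℕ) {β : ℝ} (hβ : 0 < β) : Bconst N β = (π / β) ^ N := by
  rw [Bconst, GaussianFourier.integral_rexp_neg_mul_sq_norm hβ, finrank_euclideanSpace_fin,
    ← Real.rpow_natCast]
  congr 1
  push_cast
  ring

theorem inv_Bconst_mul_Bconst_sub_le (N : ℕ) {β₀ β : ℝ} (hβ₀ : 0 < β₀) (hβ : 2 * β₀ ≤ β) :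
    (Bconst N β)⁻¹ * Bconst N (β - β₀) ≤ 2 ^ N := by
  have h₁ : 0 < β := by linarith
  have h₂ : 0 < β - β₀ := by linarith
  rw [Bconst_eq N h₁, Bconst_eq N h₂, ← inv_pow, ← mul_pow]
  have h : (π / β)⁻¹ * (π / (β - β₀)) = β / (β - β₀) := by
    field_simp
  rw [h]
  gcongr
  rw [div_le_iff₀ h₂]
  linarith

theorem lintegral_rexp_neg_mul_sq_norm_sub (N : ℕ) {β : ℝ} (hβ : 0 < β) (z : ZZ N) :
    ∫⁻ y : ZZ N, ENNReal.ofReal (Real.exp (-β * ‖y - z‖ ^ 2)) = ENNReal.ofReal (Bconst N β) := by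
  rw [lintegral_sub_right_eq_self (fun y : ZZ N => ENNReal.ofReal (Real.exp (-β * ‖y‖ ^ 2))) z,
    Bconst, ofReal_integral_eq_lintegral_ofReal (integrable_rexp_neg_mul_sq_norm hβ)
      (Eventually.of_forall fun _ => (Real.exp_pos _).le)]

theorem muE_eq_map (N : ℕ) (E : AffineSubspace ℝ (ZZ N)) {p : ZZ N} (hp : p ∈ E) :
    muE N E = (μH[(N : ℝ)] : Measure E.direction).map
      fun v : E.direction => (v : ZZ N) + p := by
  have hf : Isometry fun v : E.direction => (v : ZZ N) + p :=
    (isometry_add_right p).comp isometry_subtype_coe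
  rw [hf.map_hausdorffMeasure (Or.inl (Nat.cast_nonneg N)), muE]
  congr 1
  ext z
  constructor
  · intro hz
    exact ⟨⟨z - p, AffineSubspace.vsub_mem_direction hz hp⟩, sub_add_cancel z p⟩
  · rintro ⟨v, rfl⟩
    exact AffineSubspace.vadd_mem_of_mem_direction v.2 hp

theorem isAddHaarMeasure_hausdorffMeasure_direction {N : ℕ} {E : AffineSubspace ℝ (ZZ N)}
    (hdim : Module.finrank ℝ E.direction = N) :
    (μH[(N : ℝ)] : Measure E.direction).IsAddHaarMeasure := by
  have h := isAddHaarMeasure_hausdorffMeasure (E := E.direction)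
  rwa [hdim] at h

theorem sFinite_muE {N : ℕ} {E : AffineSubspace ℝ (ZZ N)} (hE : (E : Set (ZZ N)).Nonempty)
    (hdim : Module.finrank ℝ E.direction = N) : SFinite (muE N E) := by
  obtain ⟨p, hp⟩ := hE
  have := isAddHaarMeasure_hausdorffMeasure_direction hdim
  rw [muE_eq_map N E hp]
  infer_instance

theorem lintegral_rexp_neg_mul_sq_norm_muE_lt_top {N : ℕ} {E : AffineSubspace ℝ (ZZ N)}
    (hE : (E : Set (ZZ N)).Nonempty) (hdim : Module.finrank ℝ E.direction = N)
    {c : ℝ} (hc : 0 < c) :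
    ∫⁻ z, ENNReal.ofReal (Real.exp (-c * ‖z‖ ^ 2)) ∂muE N E < ⊤ := by
  obtain ⟨p, hp⟩ := hE
  have := isAddHaarMeasure_hausdorffMeasure_direction hdim
  rw [muE_eq_map N E hp, lintegral_map (by fun_prop) (by fun_prop)]
  have hle : ∀ v : E.direction, ENNReal.ofReal (Real.exp (-c * ‖(v : ZZ N) + p‖ ^ 2)) ≤
      ENNReal.ofReal (Real.exp (c * ‖p‖ ^ 2)) *
        ENNReal.ofReal (Real.exp (-(c / 2) * ‖v‖ ^ 2)) := by
    intro v
    rw [← ENNReal.ofReal_mul (Real.exp_pos _).le, ← Real.exp_add]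
    refine ENNReal.ofReal_le_ofReal (Real.exp_le_exp.2 ?_)
    have h₁ : ‖v‖ ≤ ‖(v : ZZ N) + p‖ + ‖p‖ := by
      simpa using norm_sub_le ((v : ZZ N) + p) p
    have h₂ : ‖v‖ ^ 2 ≤ 2 * ‖(v : ZZ N) + p‖ ^ 2 + 2 * ‖p‖ ^ 2 := by
      nlinarith [sq_nonneg (‖(v : ZZ N) + p‖ - ‖p‖), norm_nonneg v]
    nlinarith [mul_le_mul_of_nonneg_left h₂ hc.le]
  refine (lintegral_mono hle).trans_lt ?_
  rw [lintegral_const_mul _ (by fun_prop)]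
  exact ENNReal.mul_lt_top ENNReal.ofReal_lt_top
    (lintegral_rexp_neg_mul_sq_norm_lt_top _ (half_pos hc))

/-!
STATEMENT 2: For `μ = e^{−Φ} L^{2N} × H^N⌞E` with `Φ` Borel satisfying the sub-Gaussian
transversality condition `β₀‖y−z‖² + Φ(y) ≥ c(‖y‖² + ‖z‖²) − b` for all `y ∈ Z`, `z ∈ E`,
there is a constant `C < ∞` such that `μ_β(Z × Z) ≤ C` for every `β ≥ 2β₀`; in particular
each `μ_β`, `β ≥ 2β₀`, is a finite measure.
-/

theorem subGaussian_uniformly_bounded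
    (N : ℕ) (E : AffineSubspace ℝ (ZZ N)) (hE : (E : Set (ZZ N)).Nonempty)
    (hdim : Module.finrank ℝ E.direction = N)
    (Φ : ZZ N → ℝ) (hΦ : Measurable Φ)
    (β₀ c b : ℝ) (hβ₀ : 0 < β₀) (hc : 0 < c) (hb : 0 < b)
    (htrans : ∀ y : ZZ N, ∀ z ∈ E, c * (‖y‖ ^ 2 + ‖z‖ ^ 2) - b ≤ β₀ * ‖y - z‖ ^ 2 + Φ y) :
    ∃ C : ENNReal, C < ⊤ ∧ ∀ β : ℝ, 2 * β₀ ≤ β →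
      (therm ((muD N Φ).prod (muE N E)) β) Set.univ ≤ C := by
  have := sFinite_muE hE hdim
  have : SFinite (muD N Φ) := by unfold muD; infer_instance
  refine ⟨ENNReal.ofReal (2 ^ N * Real.exp b) *
    ∫⁻ z, ENNReal.ofReal (Real.exp (-c * ‖z‖ ^ 2)) ∂muE N E,
    ENNReal.mul_lt_top ENNReal.ofReal_lt_top
      (lintegral_rexp_neg_mul_sq_norm_muE_lt_top hE hdim hc), fun β hβ => ?_⟩
  have hβ' : 0 < β - β₀ := by linarith
  have hB : 0 < (Bconst N β)⁻¹ := by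
    rw [Bconst_eq N (by linarith)]
    have : 0 < β := by linarith
    positivity
  rw [therm, withDensity_apply _ MeasurableSet.univ, Measure.restrict_univ,
    lintegral_prod_symm' _ (by fun_prop), ← lintegral_const_mul _ (by fun_prop)]
  have hmem : ∀ᵐ z ∂muE N E, z ∈ E :=
    ae_restrict_mem (AffineSubspace.closed_of_finiteDimensional E).measurableSet
  refine lintegral_mono_ae (hmem.mono fun z hz => ?_)
  rw [muD, lintegral_withDensity_eq_lintegral_mul _ (by fun_prop) (by fun_prop)]
  have hle : ∀ y : ZZ N, ENNReal.ofReal (Real.exp (-Φ y)) *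
      ENNReal.ofReal ((Bconst N β)⁻¹ * Real.exp (-β * ‖y - z‖ ^ 2)) ≤
      ENNReal.ofReal ((Bconst N β)⁻¹ * Real.exp (b - c * ‖z‖ ^ 2)) *
        ENNReal.ofReal (Real.exp (-(β - β₀) * ‖y - z‖ ^ 2)) := by
    intro y
    rw [← ENNReal.ofReal_mul (by positivity), ← ENNReal.ofReal_mul (by positivity),
      mul_left_comm, mul_assoc, ← Real.exp_add, ← Real.exp_add]
    refine ENNReal.ofReal_le_ofReal
      (mul_le_mul_of_nonneg_left (Real.exp_le_exp.2 ?_) hB.le)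
    nlinarith [htrans y z hz, mul_nonneg hc.le (sq_nonneg ‖y‖)]
  refine (lintegral_mono hle).trans ?_
  rw [lintegral_const_mul _ (by fun_prop), lintegral_rexp_neg_mul_sq_norm_sub N hβ',
    ← ENNReal.ofReal_mul (by positivity), ← ENNReal.ofReal_mul (by positivity)]
  refine ENNReal.ofReal_le_ofReal ?_
  calc (Bconst N β)⁻¹ * Real.exp (b - c * ‖z‖ ^ 2) * Bconst N (β - β₀)
      = (Bconst N β)⁻¹ * Bconst N (β - β₀) * (Real.exp b * Real.exp (-c * ‖z‖ ^ 2)) := by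
        rw [← Real.exp_add]
        ring_nf
    _ ≤ 2 ^ N * (Real.exp b * Real.exp (-c * ‖z‖ ^ 2)) := by
        gcongr
        exact inv_Bconst_mul_Bconst_sub_le N hβ₀ hβ
    _ = 2 ^ N * Real.exp b * Real.exp (-c * ‖z‖ ^ 2) := by ring
end
end

section
/- Let μ = e^{−Φ} L^{2N} × H^N⌞E on Z × Z, where Φ : Z → ℝ is Borel and satisfies β₀‖y − z‖² + Φ(y) ≥ c(‖y‖² + ‖z‖²) − b for all y ∈ Z, z ∈ E (constants β₀, c, b > 0). Assume additionally that the function Ψ(ξ,η) := Φ(ξ + η) defined on E × E_0^⊥ is continuously differentiable in η, and that there are constants C < ∞, γ ≥ 0 and a function u : E → [0, ∞) with ∫_E u(ξ) e^{−c‖ξ‖²/4} dH^N(ξ) < ∞ such that ‖D₂Ψ(ξ,η)‖ ≤ C(1 + u(ξ) + ‖η‖^γ) for all ξ ∈ E, η ∈ E_0^⊥. Then μ is strongly transversal: μ_β is a finite measure for all sufficiently large β and, as β → ∞, μ_β converges narrowly to the finite measure μ_∞ on Z × Z defined by ∫ f dμ_∞ = ∫_E f(ξ, ξ) e^{−Φ(ξ)}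 dH^N(ξ) for all bounded continuous f. -/
open MeasureTheory Real Filter Topology

noncomputable section

open scoped ENNReal

section Gaussian

variable {V : Type*} [NormedAddCommGroup V] [InnerProductSpace ℝ V] [FiniteDimensional ℝ V]
  [MeasurableSpace V] [BorelSpace V]

theorem integrable_exp_neg_mul_norm_sq (ν : Measure V) [ν.IsAddHaarMeasure] {a : ℝ} (ha : 0 < a) :
    Integrable (fun x : V => Real.exp (-a * ‖x‖ ^ 2)) ν := by
  have hvol : Integrable (fun x : V => Real.exp (-a * ‖x‖ ^ 2)) := by
    have h := (GaussianFourier.integrable_cexp_neg_mul_sq_norm_add (b := (a : ℂ)) (by simpa) 0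
      (0 : V)).norm
    refine h.congr (ae_of_all _ fun x => ?_)
    simp only [Complex.norm_exp]
    congr 1
    norm_cast
    simp
  rw [ν.isAddLeftInvariant_eq_smul volume]
  exact hvol.smul_measure_nnreal

theorem integrable_exp_neg_mul_norm_add_sq {W : Type*} [NormedAddCommGroup W]
    [InnerProductSpace ℝ W] (S : Submodule ℝ W) [FiniteDimensional ℝ S] [MeasurableSpace S]
    [BorelSpace S] (ν : Measure S) [ν.IsAddHaarMeasure] (p : W) {a : ℝ} (ha : 0 < a) :
    Integrable (fun x : S => Real.exp (-a * ‖p + x‖ ^ 2)) ν := by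
  refine ((integrable_exp_neg_mul_norm_sq ν (half_pos ha)).const_mul
    (Real.exp (a * ‖p‖ ^ 2))).mono' ?_ (ae_of_all _ fun x => ?_)
  · exact Continuous.aestronglyMeasurable (by fun_prop)
  · rw [Real.norm_of_nonneg (Real.exp_nonneg _), ← Real.exp_add]
    refine Real.exp_le_exp.2 ?_
    have h1 : ‖(x : W)‖ ≤ ‖p + x‖ + ‖p‖ := by
      simpa using norm_sub_le (p + (x : W)) p
    have h2 : ‖(x : W)‖ ^ 2 ≤ (‖p + x‖ + ‖p‖) ^ 2 := by gcongr
    have h3 : ‖(x : W)‖ ^ 2 ≤ 2 * ‖p + x‖ ^ 2 + 2 * ‖p‖ ^ 2 := by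
      nlinarith [sq_nonneg (‖p + (x : W)‖ - ‖p‖)]
    rw [← Submodule.coe_norm] at *
    nlinarith

theorem lintegral_eq_mul_lintegral_comp_smul (μ : Measure V) [μ.IsAddHaarMeasure] {r : ℝ}
    (hr : r ≠ 0) (f : V → ℝ≥0∞) :
    ∫⁻ x, f x ∂μ = ENNReal.ofReal |r ^ Module.finrank ℝ V| * ∫⁻ x, f (r • x) ∂μ := by
  have h := (Homeomorph.smulOfNeZero r hr).toMeasurableEquiv.measurableEmbedding.lintegral_map
    (μ := μ) f
  have h' := Measure.map_addHaar_smul μ hr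
  simp only [Homeomorph.toMeasurableEquiv_coe, Homeomorph.smulOfNeZero_apply] at h
  change ∫⁻ x, f x ∂(Measure.map (fun x => r • x) μ) = _ at h
  change Measure.map (fun x => r • x) μ = _ at h'
  rw [← h, h', lintegral_smul_measure, smul_eq_mul, ← mul_assoc, ← ENNReal.ofReal_mul (by positivity),
    ← abs_mul, mul_inv_cancel₀ (by positivity)]
  simp

end Gaussian

section Thermalization

variable {N : ℕ}

theorem Bconst_pos {β : ℝ} (hβ : 0 < β) : 0 < Bconst N β :=
  integral_exp_pos (integrable_exp_neg_mul_norm_sq volume hβ)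

theorem neg_mul_norm_smul_sq {V : Type*} [NormedAddCommGroup V] [NormedSpace ℝ V] {r β : ℝ}
    (hβ : β * r ^ 2 = 1) (v : V) : -β * ‖r • v‖ ^ 2 = -1 * ‖v‖ ^ 2 := by
  rw [norm_smul, mul_pow, Real.norm_eq_abs, sq_abs, ← mul_assoc, neg_mul, hβ]

theorem Bconst_eq_mul_Bconst_one {r β : ℝ} (hr : 0 < r) (hβ : β * r ^ 2 = 1) :
    Bconst N β = |r ^ Module.finrank ℝ (ZZ N)| * Bconst N 1 := by
  have h := Measure.integral_comp_smul (volume : Measure (ZZ N))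
    (fun x => Real.exp (-β * ‖x‖ ^ 2)) r
  simp only [neg_mul_norm_smul_sq hβ] at h
  rw [Bconst, Bconst, h, smul_eq_mul, ← mul_assoc, ← abs_mul, mul_inv_cancel₀ (by positivity)]
  simp

variable (S : Submodule ℝ (ZZ N)) (p : ZZ N)

/-- The pair `(y, z)` with base point `p + x` in the affine space `p + S`, normal displacement of
`y` and tangential displacement of `z` obtained by scaling the components of `v` by `r`. -/
def displacedPair (r : ℝ) (q : ZZ N × S) : ZZ N × ZZ N :=
  (p + q.2 + r • (Sᗮ.orthogonalProjectionOnto q.1 : ZZ N),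
    p + q.2 - r • (S.orthogonalProjectionOnto q.1 : ZZ N))

theorem continuous_displacedPair (r : ℝ) : Continuous (displacedPair S p r) := by
  unfold displacedPair
  fun_prop

/-- The density of the thermalization in the coordinates of `displacedPair`. -/
def displacedDensity (Φ : ZZ N → ℝ) (r : ℝ) (q : ZZ N × S) : ℝ :=
  (Bconst N 1)⁻¹ * Real.exp (-1 * ‖q.1‖ ^ 2) * Real.exp (-Φ (displacedPair S p r q).1)

theorem measurable_displacedDensity {Φ : ZZ N → ℝ} (hΦ : Measurable Φ) (r : ℝ) :
    Measurable (displacedDensity S p Φ r) := by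
  have := (continuous_displacedPair S p r).measurable
  unfold displacedDensity
  fun_prop

theorem displacedDensity_nonneg (Φ : ZZ N → ℝ) (r : ℝ) (q : ZZ N × S) :
    0 ≤ displacedDensity S p Φ r q := by
  have := Bconst_pos (N := N) one_pos
  unfold displacedDensity
  positivity

theorem therm_eq_map_displacedPair {Φ : ZZ N → ℝ} (hΦ : Measurable Φ)
    (ν : Measure S) [ν.IsAddHaarMeasure] {r β : ℝ} (hr : 0 < r) (hβ : β * r ^ 2 = 1) :
    therm ((muD N Φ).prod (ν.map fun x : S => p + (x : ZZ N))) β =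
      (((volume : Measure (ZZ N)).prod ν).withDensity fun q =>
        ENNReal.ofReal (displacedDensity S p Φ r q)).map (displacedPair S p r) := by
  have hT := (continuous_displacedPair S p r).measurable
  have hd := (measurable_displacedDensity S p hΦ r).ennreal_ofReal
  have hB := Bconst_eq_mul_Bconst_one (N := N) hr hβ
  have hB1 := Bconst_pos (N := N) one_pos
  refine Measure.ext_of_lintegral _ fun g hg => ?_
  have hgT : Measurable fun q => g (displacedPair S p r q) := hg.comp hT
  rw [lintegral_map hg hT, lintegral_withDensity_eq_lintegral_mul _ hd hgT]
  rw [therm, lintegral_withDensity_eq_lintegral_mul _ (by fun_prop) hg]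
  have : SFinite (muD N Φ) := by unfold muD; infer_instance
  rw [lintegral_prod_symm' _ (by fun_prop), lintegral_map (by fun_prop) (by fun_prop)]
  have hinner : ∀ x : S, ∫⁻ y, ((fun q : ZZ N × ZZ N => ENNReal.ofReal
        ((Bconst N β)⁻¹ * Real.exp (-β * ‖q.1 - q.2‖ ^ 2))) * g) (y, p + x) ∂(muD N Φ) =
      ∫⁻ v : ZZ N, ENNReal.ofReal ((Bconst N 1)⁻¹ * Real.exp (-1 * ‖v‖ ^ 2) *
        Real.exp (-Φ (p + x + r • v))) * g (p + x + r • v, p + x) := by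
    intro x
    rw [muD, lintegral_withDensity_eq_lintegral_mul _ (by fun_prop) (by fun_prop),
      ← lintegral_add_left_eq_self _ (p + (x : ZZ N)),
      lintegral_eq_mul_lintegral_comp_smul volume hr.ne',
      ← lintegral_const_mul _ (by fun_prop)]
    refine lintegral_congr fun v => ?_
    simp only [Pi.mul_apply, add_sub_cancel_left]
    rw [← mul_assoc, ← mul_assoc, ← ENNReal.ofReal_mul (by positivity),
      ← ENNReal.ofReal_mul (by positivity)]
    congr 2
    rw [neg_mul_norm_smul_sq hβ, hB]
    have : |r ^ Module.finrank ℝ (ZZ N)| ≠ 0 := by positivity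
    field_simp
  simp only [hinner]
  rw [lintegral_lintegral_swap (by
    refine Measurable.aemeasurable ?_
    unfold Function.uncurry
    fun_prop), lintegral_prod _ (by fun_prop)]
  refine lintegral_congr fun v => ?_
  rw [← lintegral_sub_right_eq_self _ (r • S.orthogonalProjectionOnto v)]
  refine lintegral_congr fun x => ?_
  have hv : r • v = r • (S.orthogonalProjectionOnto v : ZZ N) +
      r • (Sᗮ.orthogonalProjectionOnto v : ZZ N) := by
    rw [← smul_add]
    exact congrArg (r • ·) (S.starProjection_add_starProjection_orthogonal v).symm
  have h1 : p + ((x - r • S.orthogonalProjectionOnto v : S) : ZZ N) + r • v =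
      p + x + r • (Sᗮ.orthogonalProjectionOnto v : ZZ N) := by
    rw [hv]
    push_cast
    module
  have h2 : p + ((x - r • S.orthogonalProjectionOnto v : S) : ZZ N) =
      p + x - r • (S.orthogonalProjectionOnto v : ZZ N) := by
    push_cast
    module
  rw [h1, h2]
  rfl

/-- The integrable envelope of `displacedDensity`. -/
def displacedEnvelope (b c : ℝ) (q : ZZ N × S) : ℝ :=
  (Bconst N 1)⁻¹ * Real.exp b *
    (Real.exp (-(1 / 2) * ‖q.1‖ ^ 2) * Real.exp (-c * ‖p + q.2‖ ^ 2))

theorem integrable_displacedEnvelope (ν : Measure S) [ν.IsAddHaarMeasure] (b : ℝ) {c : ℝ}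
    (hc : 0 < c) :
    Integrable (displacedEnvelope S p b c) ((volume : Measure (ZZ N)).prod ν) :=
  ((integrable_exp_neg_mul_norm_sq volume one_half_pos).mul_prod
    (integrable_exp_neg_mul_norm_add_sq S ν p hc)).const_mul _

theorem displacedDensity_le_displacedEnvelope {Φ : ZZ N → ℝ} {β₀ c b r : ℝ} (hc : 0 < c)
    (hβ₀ : 0 < β₀)
    (htrans : ∀ (y : ZZ N) (x : S),
      c * (‖y‖ ^ 2 + ‖p + x‖ ^ 2) - b ≤ β₀ * ‖y - (p + x)‖ ^ 2 + Φ y)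
    (hr : β₀ * r ^ 2 ≤ 1 / 2) (q : ZZ N × S) :
    displacedDensity S p Φ r q ≤ displacedEnvelope S p b c q := by
  obtain ⟨v, x⟩ := q
  have hB := Bconst_pos (N := N) one_pos
  have h := htrans (displacedPair S p r (v, x)).1 x
  have hy : ‖(displacedPair S p r (v, x)).1 - (p + x)‖ ^ 2 ≤ r ^ 2 * ‖v‖ ^ 2 := by
    simp only [displacedPair, add_sub_cancel_left]
    rw [norm_smul, mul_pow, Real.norm_eq_abs r, sq_abs]
    gcongr
    exact Sᗮ.norm_orthogonalProjectionOnto_apply_le v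
  unfold displacedDensity displacedEnvelope
  rw [mul_assoc, mul_assoc, ← Real.exp_add, ← Real.exp_add, ← Real.exp_add]
  refine mul_le_mul_of_nonneg_left (Real.exp_le_exp.2 ?_) (by positivity)
  have h1 : β₀ * ‖(displacedPair S p r (v, x)).1 - (p + x)‖ ^ 2 ≤ 1 / 2 * ‖v‖ ^ 2 := by
    calc _ ≤ β₀ * (r ^ 2 * ‖v‖ ^ 2) := by gcongr
      _ = β₀ * r ^ 2 * ‖v‖ ^ 2 := by ring
      _ ≤ _ := by gcongr
  have h2 : 0 ≤ c * ‖(displacedPair S p r (v, x)).1‖ ^ 2 := by positivity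
  dsimp only at *
  linarith

theorem tendsto_displacedDensity_mul {Φ : ZZ N → ℝ}
    (hcont : ∀ x : S, Continuous fun η : Sᗮ => Φ (p + x + η)) {ι : Type*} {l : Filter ι}
    {r : ι → ℝ} (hr : Tendsto r l (𝓝 0)) (f : BoundedContinuousFunction (ZZ N × ZZ N) ℝ)
    (q : ZZ N × S) :
    Tendsto (fun i => displacedDensity S p Φ (r i) q * f (displacedPair S p (r i) q)) l
      (𝓝 ((Bconst N 1)⁻¹ * Real.exp (-1 * ‖q.1‖ ^ 2) *
        (f (p + q.2, p + q.2) * Real.exp (-Φ (p + q.2))))) := by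
  obtain ⟨v, x⟩ := q
  have hpair : Continuous fun t : ℝ => displacedPair S p t (v, x) := by
    unfold displacedPair
    fun_prop
  have hdens : Continuous fun t : ℝ => displacedDensity S p Φ t (v, x) := by
    have h : Continuous fun t : ℝ =>
        Φ (p + x + ((t • Sᗮ.orthogonalProjectionOnto v : Sᗮ) : ZZ N)) :=
      (hcont x).comp (by fun_prop)
    exact continuous_const.mul (Real.continuous_exp.comp h.neg)
  have hlim : displacedDensity S p Φ 0 (v, x) * f (displacedPair S p 0 (v, x)) =
      (Bconst N 1)⁻¹ * Real.exp (-1 * ‖v‖ ^ 2) * (f (p + x, p + x) * Real.exp (-Φ (p + x))) := by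
    simp only [displacedDensity, displacedPair, zero_smul, add_zero, sub_zero]
    ring
  rw [← hlim]
  exact ((hdens.mul (f.continuous.comp hpair)).tendsto 0).comp hr

theorem integral_gaussian_mul_prod (ν : Measure S) [SFinite ν] (g : S → ℝ) :
    ∫ q : ZZ N × S, (Bconst N 1)⁻¹ * Real.exp (-1 * ‖q.1‖ ^ 2) * g q.2
      ∂((volume : Measure (ZZ N)).prod ν) = ∫ x, g x ∂ν := by
  rw [integral_prod_mul (fun v : ZZ N => (Bconst N 1)⁻¹ * Real.exp (-1 * ‖v‖ ^ 2)) g,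
    integral_const_mul]
  change (Bconst N 1)⁻¹ * Bconst N 1 * _ = _
  rw [inv_mul_cancel₀ (Bconst_pos one_pos).ne', one_mul]

end Thermalization

theorem hausdorffMeasure_restrict_affineSubspace {N : ℕ} (E : AffineSubspace ℝ (ZZ N))
    {p : ZZ N} (hp : p ∈ E) :
    (μH[(N : ℝ)]).restrict (E : Set (ZZ N)) =
      (μH[(N : ℝ)] : Measure E.direction).map fun x : E.direction => p + (x : ZZ N) := by
  have hiso : Isometry fun x : E.direction => p + (x : ZZ N) :=
    (isometry_add_left p).comp isometry_subtype_coe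
  rw [hiso.map_hausdorffMeasure (.inl N.cast_nonneg)]
  congr 1
  ext z
  constructor
  · intro hz
    exact ⟨⟨z - p, E.vsub_mem_direction hz hp⟩, by simp⟩
  · rintro ⟨x, rfl⟩
    simpa [add_comm] using E.vadd_mem_of_mem_direction x.2 hp

/-!
STATEMENT 6: Diagonal concentration of sub-Gaussian measures. Under the sub-Gaussian
transversality condition and the regularity/growth assumptions on
`Ψ(ξ,η) := Φ(ξ+η)` (`ξ ∈ E`, `η ∈ E₀ᗮ`), the measure `μ = e^{−Φ}L^{2N} × H^N⌞E` is
strongly transversal: `μ_β` is finite for all sufficiently large `β` and, as `β → ∞`,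
`μ_β` converges narrowly to the finite measure `μ_∞` defined by
`∫ f dμ_∞ = ∫_E f(ξ,ξ) e^{−Φ(ξ)} dH^N(ξ)`.
-/

theorem subGaussian_strongly_transversal
    (N : ℕ) (E : AffineSubspace ℝ (ZZ N)) (hE : (E : Set (ZZ N)).Nonempty)
    (hdim : Module.finrank ℝ E.direction = N)
    (Φ : ZZ N → ℝ) (hΦ : Measurable Φ)
    (β₀ c b : ℝ) (hβ₀ : 0 < β₀) (hc : 0 < c) (hb : 0 < b)
    (htrans : ∀ y : ZZ N, ∀ z ∈ E, c * (‖y‖ ^ 2 + ‖z‖ ^ 2) - b ≤ β₀ * ‖y - z‖ ^ 2 + Φ y)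
    -- i) Ψ(ξ,·) is continuously differentiable on E₀ᗮ for each ξ ∈ E
    (hC1 : ∀ ξ ∈ E, ContDiff ℝ 1 (fun η : E.directionᗮ => Φ (ξ + η)))
    -- ii) growth condition on D₂Ψ
    (C : ℝ) (hC : 0 < C) (γ : ℝ) (hγ : 0 ≤ γ)
    (u : ZZ N → ℝ) (hu : ∀ ξ ∈ E, 0 ≤ u ξ)
    (huint : ∫⁻ ξ in (E : Set (ZZ N)),
        ENNReal.ofReal (u ξ * Real.exp (-c * ‖ξ‖ ^ 2 / 4)) ∂(μH[(N : ℝ)]) < ⊤)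
    (hgrowth : ∀ ξ ∈ E, ∀ η : E.directionᗮ,
        ‖fderiv ℝ (fun η' : E.directionᗮ => Φ (ξ + η')) η‖ ≤ C * (1 + u ξ + ‖η‖ ^ γ)) :
    (∃ β₁ : ℝ, ∀ β : ℝ, β₁ ≤ β → IsFiniteMeasure (therm ((muD N Φ).prod (muE N E)) β)) ∧
    Integrable (fun ξ => Real.exp (-Φ ξ)) ((μH[(N : ℝ)]).restrict (E : Set (ZZ N))) ∧
    (∀ f : BoundedContinuousFunction (ZZ N × ZZ N) ℝ,
      Tendsto (fun β : ℝ => ∫ q, f q ∂(therm ((muD N Φ).prod (muE N E)) β)) atTop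
        (𝓝 (∫ ξ in (E : Set (ZZ N)), f (ξ, ξ) * Real.exp (-Φ ξ) ∂(μH[(N : ℝ)])))) := by
  obtain ⟨p, hp⟩ := hE
  set S := E.direction
  set ν : Measure S := μH[(N : ℝ)]
  have hν : ν.IsAddHaarMeasure := by
    have h : (μH[(Module.finrank ℝ S : ℝ)] : Measure S).IsAddHaarMeasure := inferInstance
    rwa [hdim] at h
  have hmem : ∀ x : S, p + (x : ZZ N) ∈ E := fun x => by
    simpa [add_comm] using E.vadd_mem_of_mem_direction x.2 hp
  have hmap := hausdorffMeasure_restrict_affineSubspace E hp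
  have hcont : ∀ x : S, Continuous fun η : Sᗮ => Φ (p + x + η) := fun x =>
    (hC1 _ (hmem x)).continuous
  have hemb : MeasurableEmbedding fun x : S => p + (x : ZZ N) :=
    (measurableEmbedding_addLeft p).comp (.subtype_coe S.closed_of_finiteDimensional.measurableSet)
  have hbound : ∀ β : ℝ, 2 * β₀ ≤ β → ∀ q : ZZ N × S,
      displacedDensity S p Φ (√β)⁻¹ q ≤ displacedEnvelope S p b c q := by
    intro β hβ
    have hβpos : 0 < β := by linarith
    refine displacedDensity_le_displacedEnvelope S p hc hβ₀ (fun y x => htrans y _ (hmem x)) ?_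
    rw [inv_pow, Real.sq_sqrt hβpos.le, ← div_eq_mul_inv, div_le_iff₀ hβpos]
    linarith
  have htherm : ∀ β : ℝ, 2 * β₀ ≤ β → therm ((muD N Φ).prod (muE N E)) β =
      (((volume : Measure (ZZ N)).prod ν).withDensity fun q =>
        ENNReal.ofReal (displacedDensity S p Φ (√β)⁻¹ q)).map (displacedPair S p (√β)⁻¹) := by
    intro β hβ
    have hβpos : 0 < β := by linarith
    rw [muE, hmap]
    refine therm_eq_map_displacedPair S p hΦ ν (by positivity) ?_
    rw [inv_pow, Real.sq_sqrt hβpos.le, mul_inv_cancel₀ hβpos.ne']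
  have hint : ∀ β : ℝ, 2 * β₀ ≤ β →
      Integrable (displacedDensity S p Φ (√β)⁻¹) ((volume : Measure (ZZ N)).prod ν) := by
    intro β hβ
    refine (integrable_displacedEnvelope S p ν b hc).mono'
      (measurable_displacedDensity S p hΦ _).aestronglyMeasurable (ae_of_all _ fun q => ?_)
    rw [Real.norm_of_nonneg (displacedDensity_nonneg S p Φ _ q)]
    exact hbound β hβ q
  refine ⟨⟨2 * β₀, fun β hβ => ?_⟩, ?_, fun f => ?_⟩
  · rw [htherm β hβ]
    have := isFiniteMeasure_withDensity_ofReal (hint β hβ).2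
    infer_instance
  · rw [hmap, hemb.integrable_map_iff]
    refine ((integrable_exp_neg_mul_norm_add_sq S ν p hc).const_mul (Real.exp b)).mono'
      (hΦ.neg.exp.comp hemb.measurable).aestronglyMeasurable (ae_of_all _ fun x => ?_)
    have h := htrans (p + x) (p + x) (hmem x)
    rw [sub_self, norm_zero] at h
    rw [Function.comp_apply, Real.norm_of_nonneg (Real.exp_nonneg _), ← Real.exp_add]
    refine Real.exp_le_exp.2 ?_
    have : 0 ≤ c * ‖p + (x : ZZ N)‖ ^ 2 := by positivity
    linarith
  · rw [hmap, hemb.integral_map,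
      ← integral_gaussian_mul_prod S ν fun x => f (p + x, p + x) * Real.exp (-Φ (p + x))]
    have heq : (fun β : ℝ => ∫ q, displacedDensity S p Φ (√β)⁻¹ q * f (displacedPair S p (√β)⁻¹ q)
          ∂((volume : Measure (ZZ N)).prod ν)) =ᶠ[atTop]
        fun β => ∫ q, f q ∂(therm ((muD N Φ).prod (muE N E)) β) := by
      filter_upwards [eventually_ge_atTop (2 * β₀)] with β hβ
      rw [htherm β hβ, integral_map (continuous_displacedPair S p _).aemeasurable
        f.continuous.aestronglyMeasurable, integral_withDensity_eq_integral_toReal_smul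
        (measurable_displacedDensity S p hΦ _).ennreal_ofReal (by simp)]
      simp only [ENNReal.toReal_ofReal (displacedDensity_nonneg S p Φ _ _), smul_eq_mul]
    refine Tendsto.congr' heq ?_
    refine tendsto_integral_filter_of_dominated_convergence
      (fun q => displacedEnvelope S p b c q * ‖f‖) (.of_forall fun β => ?_) ?_
      ((integrable_displacedEnvelope S p ν b hc).mul_const _) (ae_of_all _ fun q => ?_)
    · exact ((measurable_displacedDensity S p hΦ _).mul (f.continuous.measurable.comp
        (continuous_displacedPair S p _).measurable)).aestronglyMeasurable
    · filter_upwards [eventually_ge_atTop (2 * β₀)] with β hβ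
      refine ae_of_all _ fun q => ?_
      have h0 := displacedDensity_nonneg S p Φ (√β)⁻¹ q
      have h1 := hbound β hβ q
      rw [norm_mul, Real.norm_of_nonneg h0]
      exact mul_le_mul h1 (f.norm_coe_le_norm _) (norm_nonneg _) (h0.trans h1)
    · exact tendsto_displacedDensity_mul S p hcont
        (tendsto_inv_atTop_zero.comp Real.tendsto_sqrt_atTop) f q
end
end

section
/- Let Z be a 2N-dimensional real inner product space, E an N-dimensional affine subspace, P_E the orthogonal projection onto E, μ_D a nonnegative Radon measure on Z, p ∈ Z, A ⊆ Z a Borel set with p ∈ A and 0 < μ_D(A) < ∞, and ε > 0 with ∫_A ‖y − p‖² dμ_D(y) ≤ ε² μ_D(A). Then for every β > 0, exp(−β‖p − P_E(p)‖²) ≤ e^{β ε²} · (1/μ_D(A)) ∫_A exp(−(β/2)‖y − P_E(y)‖²) dμ_D(y). -/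
open MeasureTheory Real

noncomputable section

/-- Jensen's inequality for `x ↦ exp (-β * x)`: if `g` has average at most `c` over `A`, then
`exp (-β * g)` has average at least `exp (-β * c)`. -/
theorem ofReal_exp_neg_mul_measure_le_setLIntegral {X : Type*} [MeasurableSpace X]
    {μ : Measure X} {A : Set X} (hA : μ A ≠ ⊤) {g : X → ℝ} (hg : Measurable g)
    (hg0 : ∀ x, 0 ≤ g x) {β c : ℝ} (hβ : 0 ≤ β) (hc : 0 ≤ c)
    (hmean : ∫⁻ x in A, ENNReal.ofReal (g x) ∂μ ≤ ENNReal.ofReal c * μ A) :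
    μ A ≤ ENNReal.ofReal (exp (β * c)) * ∫⁻ x in A, ENNReal.ofReal (exp (-β * g x)) ∂μ := by
  have htangent (x : X) : 1 + ENNReal.ofReal (β * c) ≤
      ENNReal.ofReal (exp (β * c)) * ENNReal.ofReal (exp (-β * g x)) +
        ENNReal.ofReal β * ENNReal.ofReal (g x) := by
    have hexp := add_one_le_exp (β * c + -β * g x)
    rw [← ENNReal.ofReal_one, ← ENNReal.ofReal_add zero_le_one (by positivity),
      ← ENNReal.ofReal_mul (exp_pos _).le, ← exp_add, ← ENNReal.ofReal_mul hβ,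
      ← ENNReal.ofReal_add (exp_pos _).le (mul_nonneg hβ (hg0 x))]
    exact ENNReal.ofReal_le_ofReal (by linarith)
  have hint := lintegral_mono (μ := μ.restrict A) htangent
  rw [setLIntegral_const, lintegral_add_right _ (by fun_prop),
    lintegral_const_mul' _ _ ENNReal.ofReal_ne_top,
    lintegral_const_mul' _ _ ENNReal.ofReal_ne_top, add_mul, one_mul] at hint
  refine (ENNReal.add_le_add_iff_right
    (ENNReal.mul_ne_top (ENNReal.ofReal_ne_top (r := β * c)) hA)).1 (hint.trans ?_)
  rw [ENNReal.ofReal_mul hβ, mul_assoc]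
  gcongr

/-- The squared distance to the nearest point in `E`, compared at two points. -/
theorem sq_norm_sub_le_of_forall_norm_sub_le {V : Type*} [SeminormedAddCommGroup V] {E : Set V}
    {P : V → V} (hPmem : ∀ y, P y ∈ E) (hPmin : ∀ y, ∀ w ∈ E, ‖y - P y‖ ≤ ‖y - w‖) (p y : V) :
    ‖y - P y‖ ^ 2 ≤ 2 * (‖y - p‖ ^ 2 + ‖p - P p‖ ^ 2) :=
  calc
    ‖y - P y‖ ^ 2 ≤ (‖y - p‖ + ‖p - P p‖) ^ 2 := by
      gcongr
      exact (hPmin y _ (hPmem p)).trans (norm_sub_le_norm_sub_add_norm_sub y p (P p))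
    _ ≤ 2 * (‖y - p‖ ^ 2 + ‖p - P p‖ ^ 2) := add_sq_le

/-!
STATEMENT 9: Jensen-type bound. Under the second-moment condition
`∫_A ‖y − p‖² dμ_D(y) ≤ ε² μ_D(A)`, for every `β > 0`,
`exp(−β‖p − P_E(p)‖²) ≤ e^{βε²} (1/μ_D(A)) ∫_A exp(−(β/2)‖y − P_E(y)‖²) dμ_D(y)`,
where `P_E` is the orthogonal (closest-point) projection onto `E`.
The inequality is stated multiplied through by `μ_D(A)`, with the nonnegative
integral expressed as a lower integral.
-/

theorem jensen_projection_exponential_bound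
    (N : ℕ) (E : AffineSubspace ℝ (ZZ N)) (hE : (E : Set (ZZ N)).Nonempty)
    (hdim : Module.finrank ℝ E.direction = N)
    (P : ZZ N → ZZ N)
    (hPmem : ∀ y : ZZ N, P y ∈ E)
    (hPmin : ∀ y : ZZ N, ∀ w ∈ E, ‖y - P y‖ ≤ ‖y - w‖)
    (μD : Measure (ZZ N))
    (p : ZZ N) (A : Set (ZZ N)) (hA : MeasurableSet A) (hpA : p ∈ A)
    (hApos : 0 < μD A) (hAfin : μD A < ⊤)
    (ε : ℝ) (hε : 0 < ε)
    (hmom : ∫⁻ y in A, ENNReal.ofReal (‖y - p‖ ^ 2) ∂μD ≤ ENNReal.ofReal (ε ^ 2) * μD A)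
    (β : ℝ) (hβ : 0 < β) :
    ENNReal.ofReal (Real.exp (-β * ‖p - P p‖ ^ 2)) * μD A
      ≤ ENNReal.ofReal (Real.exp (β * ε ^ 2)) *
        ∫⁻ y in A, ENNReal.ofReal (Real.exp (-(β / 2) * ‖y - P y‖ ^ 2)) ∂μD := by
  have hpoint (y : ZZ N) :
      ENNReal.ofReal (exp (-β * ‖p - P p‖ ^ 2)) * ENNReal.ofReal (exp (-β * ‖y - p‖ ^ 2)) ≤
        ENNReal.ofReal (exp (-(β / 2) * ‖y - P y‖ ^ 2)) := by
    rw [← ENNReal.ofReal_mul (exp_pos _).le, ← exp_add]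
    refine ENNReal.ofReal_le_ofReal (exp_le_exp.2 ?_)
    have hdist := mul_le_mul_of_nonneg_left
      (sq_norm_sub_le_of_forall_norm_sub_le (E := (E : Set (ZZ N))) hPmem hPmin p y) hβ.le
    linarith
  have hjensen := ofReal_exp_neg_mul_measure_le_setLIntegral hAfin.ne
    (g := fun y ↦ ‖y - p‖ ^ 2) (by fun_prop) (fun y ↦ by positivity) hβ.le (sq_nonneg ε) hmom
  refine (mul_le_mul_right hjensen _).trans ?_
  rw [mul_left_comm, ← lintegral_const_mul' _ _ ENNReal.ofReal_ne_top]
  gcongr with y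
  exact hpoint y
end
end

section
/- Let Z be a 2N-dimensional real inner product space, μ_D a nonnegative Radon measure on Z, p ∈ Z, A ⊆ Z Borel with 0 < μ_D(A) < ∞, β > 0, and ε ∈ (0, 1] with ∫_A ‖y − p‖² dμ_D(y) ≤ ε² μ_D(A). Let C_* > 0 and z ∈ Z satisfy ‖p − z‖ > C_*, and set a := (1/2)(1 + C_*^{−2})^{−1}. Then exp(−β‖p − z‖²) ≤ (1/μ_D(A)) ∫_A exp(−a β‖y − z‖²) dμ_D(y). -/
open MeasureTheory Real

noncomputable section

/-!
STATEMENT 10: far-field cell bound. If `∫_A ‖y − p‖² dμ_D ≤ ε² μ_D(A)` with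
`ε ∈ (0,1]`, `‖p − z‖ > C_*` and `a := (1/2)(1 + C_*⁻²)⁻¹`, then
`exp(−β‖p − z‖²) ≤ (1/μ_D(A)) ∫_A exp(−aβ‖y − z‖²) dμ_D(y)`.
The inequality is stated multiplied through by `μ_D(A)`, with the nonnegative
integral expressed as a lower integral.
-/

/-- The tangent-line bound for `exp` behind the far-field cell bound: it is affine in `‖y - p‖ ^ 2`
and has value at least `exp (-β * ‖p - z‖ ^ 2)` where `‖y - p‖ ^ 2 ≤ 1`. -/
theorem exp_farfield_tangent_bound {E : Type*} [SeminormedAddCommGroup E] {β C : ℝ} (hβ : 0 < β)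
    (hC : 0 < C) {p z : E} (hz : C < ‖p - z‖) (y : E) :
    exp (-β * ‖p - z‖ ^ 2) + exp (-β * ‖p - z‖ ^ 2) * (β * (1 + C⁻¹ ^ 2)⁻¹)
      ≤ exp (-((1 / 2) * (1 + C⁻¹ ^ 2)⁻¹ * β) * ‖y - z‖ ^ 2)
        + exp (-β * ‖p - z‖ ^ 2) * (β * (1 + C⁻¹ ^ 2)⁻¹) * ‖y - p‖ ^ 2 := by
  set R := ‖p - z‖ ^ 2 with hR
  set t := ‖y - p‖ ^ 2 with ht
  set k := (1 + C⁻¹ ^ 2)⁻¹ with hk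
  have hkpos : 0 < k := by positivity
  have hkR : k * (1 + R) ≤ R := by
    have h1 : 1 ≤ C⁻¹ ^ 2 * R := by
      rw [inv_pow, inv_mul_eq_div, one_le_div (by positivity)]
      exact pow_le_pow_left₀ hC.le hz.le 2
    rw [hk, inv_mul_le_iff₀ (by positivity)]
    linarith
  have hy : ‖y - z‖ ^ 2 ≤ 2 * (t + R) := by
    have h1 : ‖y - z‖ ≤ ‖y - p‖ + ‖p - z‖ := norm_sub_le_norm_sub_add_norm_sub y p z
    nlinarith [sq_nonneg (‖y - p‖ - ‖p - z‖), norm_nonneg (y - z)]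
  have hexp : -(k * β * (t + R)) ≤ -((1 / 2) * k * β) * ‖y - z‖ ^ 2 := by
    nlinarith [mul_le_mul_of_nonneg_left hy (mul_pos hkpos hβ).le]
  have htan : 1 + β * k - β * k * t ≤ exp (β * R - k * β * (t + R)) := by
    have := add_one_le_exp (β * R - k * β * (t + R))
    nlinarith [mul_le_mul_of_nonneg_left hkR hβ.le]
  have hmul : exp (-β * R) * (1 + β * k - β * k * t)
      ≤ exp (-((1 / 2) * k * β) * ‖y - z‖ ^ 2) := calc
    _ ≤ exp (-β * R) * exp (β * R - k * β * (t + R)) := by gcongr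
    _ = exp (-(k * β * (t + R))) := by rw [← exp_add]; ring_nf
    _ ≤ _ := exp_le_exp.mpr hexp
  linarith

theorem farfield_cell_bound
    (N : ℕ) (μD : Measure (ZZ N))
    (p : ZZ N) (A : Set (ZZ N)) (hA : MeasurableSet A)
    (hApos : 0 < μD A) (hAfin : μD A < ⊤)
    (β : ℝ) (hβ : 0 < β)
    (ε : ℝ) (hε : 0 < ε) (hε1 : ε ≤ 1)
    (hmom : ∫⁻ y in A, ENNReal.ofReal (‖y - p‖ ^ 2) ∂μD ≤ ENNReal.ofReal (ε ^ 2) * μD A)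
    (Cstar : ℝ) (hCstar : 0 < Cstar)
    (z : ZZ N) (hz : Cstar < ‖p - z‖) :
    ENNReal.ofReal (Real.exp (-β * ‖p - z‖ ^ 2)) * μD A
      ≤ ∫⁻ y in A, ENNReal.ofReal
          (Real.exp (-((1 / 2) * (1 + Cstar⁻¹ ^ 2)⁻¹ * β) * ‖y - z‖ ^ 2)) ∂μD := by
  have hc : 0 ≤ exp (-β * ‖p - z‖ ^ 2) * (β * (1 + Cstar⁻¹ ^ 2)⁻¹) := by positivity
  have hpt := exp_farfield_tangent_bound hβ hCstar hz
  generalize exp (-β * ‖p - z‖ ^ 2) * (β * (1 + Cstar⁻¹ ^ 2)⁻¹) = c at hc hpt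
  have hmom' : ∫⁻ y in A, ENNReal.ofReal (‖y - p‖ ^ 2) ∂μD ≤ μD A :=
    hmom.trans <| mul_le_of_le_one_left' <|
      ENNReal.ofReal_le_one.mpr (pow_le_one₀ hε.le hε1)
  refine (ENNReal.add_le_add_iff_right
    (ENNReal.mul_ne_top (ENNReal.ofReal_ne_top (r := c)) hAfin.ne)).mp ?_
  calc
    _ = ∫⁻ _ in A, ENNReal.ofReal (exp (-β * ‖p - z‖ ^ 2) + c) ∂μD := by
      rw [setLIntegral_const, ENNReal.ofReal_add (exp_pos _).le hc, add_mul]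
    _ ≤ ∫⁻ y in A, (ENNReal.ofReal
          (exp (-((1 / 2) * (1 + Cstar⁻¹ ^ 2)⁻¹ * β) * ‖y - z‖ ^ 2))
          + ENNReal.ofReal c * ENNReal.ofReal (‖y - p‖ ^ 2)) ∂μD := by
      refine lintegral_mono fun y => ?_
      rw [← ENNReal.ofReal_mul hc, ← ENNReal.ofReal_add (exp_pos _).le (by positivity)]
      exact ENNReal.ofReal_le_ofReal (hpt y)
    _ = _ + ENNReal.ofReal c * ∫⁻ y in A, ENNReal.ofReal (‖y - p‖ ^ 2) ∂μD := by
      rw [lintegral_add_left (by fun_prop), lintegral_const_mul _ (by fun_prop)]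
    _ ≤ _ := by gcongr
end
end

section
/- Let μ_D be a nonnegative Radon measure on Z, E an N-dimensional affine subspace of Z, and μ := μ_D × H^N⌞E. Let P ⊂ Z be a countable set, {A_p : p ∈ P} a Borel partition of Z with p ∈ A_p and μ_D(A_p) < ∞ for each p, and weights m_p ≥ 0 with m_p ≤ c̄ μ_D(A_p) for a constant c̄ > 0. Suppose ε > 0 satisfies ∫_{A_p} ‖y − p‖² dμ_D(y) ≤ ε² μ_D(A_p) for all p ∈ P. Let μ_disc := (Σ_{p∈P} m_p δ_p) × H^N⌞E. Then for every β > 0, the thermalized measures satisfy ‖(μ_disc)_β‖_TV ≤ c̄ e^{β ε²} 2^N ‖μ_{β/2}‖_TV. -/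
open MeasureTheory Real Filter Topology

noncomputable section

theorem inv_Bconst_eq_two_pow_mul (N : ℕ) {β : ℝ} (hβ : 0 < β) :
    (Bconst N β)⁻¹ = 2 ^ N * (Bconst N (β / 2))⁻¹ := by
  rw [Bconst_eq N hβ, Bconst_eq N (half_pos hβ), ← inv_pow, ← inv_pow, ← mul_pow]
  congr 1
  field_simp

/-- The `N`-dimensional Hausdorff measure restricted to an `N`-dimensional affine subspace is
σ-finite. -/
theorem sigmaFinite_muE {N : ℕ} {E : AffineSubspace ℝ (ZZ N)} (hE : (E : Set (ZZ N)).Nonempty)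
    (hdim : Module.finrank ℝ E.direction = N) : SigmaFinite (muE N E) := by
  obtain ⟨x, hx⟩ := hE
  let f : E.direction → ZZ N := fun v => (v : ZZ N) +ᵥ x
  have hf : Isometry f := (IsometryEquiv.vaddConst x).isometry.comp isometry_subtype_coe
  have hrange : Set.range f = E := by
    ext y
    constructor
    · rintro ⟨v, rfl⟩
      exact AffineSubspace.vadd_mem_of_mem_direction v.2 hx
    · intro hy
      exact ⟨⟨y -ᵥ x, AffineSubspace.vsub_mem_direction hy hx⟩, vsub_vadd y x⟩
  have hmap : muE N E = (μH[(N : ℝ)] : Measure E.direction).map f := by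
    rw [hf.map_hausdorffMeasure (Or.inl N.cast_nonneg), hrange, muE]
  have hHaar : (μH[(N : ℝ)] : Measure E.direction).IsAddHaarMeasure := by
    have h := isAddHaarMeasure_hausdorffMeasure (E := E.direction)
    rwa [hdim] at h
  rw [hmap]
  exact hf.isClosedEmbedding.measurableEmbedding.sigmaFinite_map

/-- The tangent-line form of Jensen's inequality for `exp (-·)`, with a bound on the mean. -/
theorem exp_neg_mul_measure_univ_le_lintegral {α : Type*} [MeasurableSpace α] {μ : Measure α}
    [IsFiniteMeasure μ] {g : α → ℝ} (hg : Measurable g) (hg0 : ∀ x, 0 ≤ g x) {s : ℝ} (hs : 0 ≤ s)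
    (h : ∫⁻ x, ENNReal.ofReal (g x) ∂μ ≤ ENNReal.ofReal s * μ Set.univ) :
    ENNReal.ofReal (Real.exp (-s)) * μ Set.univ ≤ ∫⁻ x, ENNReal.ofReal (Real.exp (-g x)) ∂μ := by
  set c := ENNReal.ofReal (Real.exp (-s)) with hc
  have hpt : ∀ x, c + c * ENNReal.ofReal s ≤
      ENNReal.ofReal (Real.exp (-g x)) + c * ENNReal.ofReal (g x) := by
    intro x
    have hexp : Real.exp (-g x) = Real.exp (-s) * Real.exp (s - g x) := by
      rw [← Real.exp_add]
      ring_nf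
    have htangent := mul_le_mul_of_nonneg_left (Real.add_one_le_exp (s - g x))
      (Real.exp_nonneg (-s))
    rw [hc, ← ENNReal.ofReal_mul (Real.exp_nonneg _), ← ENNReal.ofReal_mul (Real.exp_nonneg _),
      ← ENNReal.ofReal_add (Real.exp_nonneg _) (mul_nonneg (Real.exp_nonneg _) hs),
      ← ENNReal.ofReal_add (Real.exp_nonneg _) (mul_nonneg (Real.exp_nonneg _) (hg0 x))]
    apply ENNReal.ofReal_le_ofReal
    linarith
  have hfin : c * (ENNReal.ofReal s * μ Set.univ) ≠ ⊤ := by finiteness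
  refine (ENNReal.add_le_add_iff_right hfin).mp ?_
  calc c * μ Set.univ + c * (ENNReal.ofReal s * μ Set.univ)
      = ∫⁻ _, (c + c * ENNReal.ofReal s) ∂μ := by rw [lintegral_const]; ring
    _ ≤ ∫⁻ x, (ENNReal.ofReal (Real.exp (-g x)) + c * ENNReal.ofReal (g x)) ∂μ :=
        lintegral_mono hpt
    _ = ∫⁻ x, ENNReal.ofReal (Real.exp (-g x)) ∂μ + c * ∫⁻ x, ENNReal.ofReal (g x) ∂μ := by
        rw [lintegral_add_left (by fun_prop), lintegral_const_mul _ (by fun_prop)]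
    _ ≤ _ := by gcongr

theorem exp_neg_mul_exp_neg_le {V : Type*} [SeminormedAddCommGroup V] {β : ℝ} (hβ : 0 ≤ β)
    (y p z : V) :
    Real.exp (-(β * ‖y - p‖ ^ 2)) * Real.exp (-β * ‖p - z‖ ^ 2) ≤
      Real.exp (-(β / 2) * ‖y - z‖ ^ 2) := by
  rw [← Real.exp_add, Real.exp_le_exp]
  have htri : ‖y - z‖ ≤ ‖y - p‖ + ‖p - z‖ := norm_sub_le_norm_sub_add_norm_sub y p z
  have hsq : ‖y - z‖ ^ 2 ≤ 2 * (‖y - p‖ ^ 2 + ‖p - z‖ ^ 2) :=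
    (pow_le_pow_left₀ (norm_nonneg _) htri 2).trans add_sq_le
  nlinarith [mul_le_mul_of_nonneg_left hsq hβ]

theorem therm_prod_univ {N : ℕ} (μ ν : Measure (ZZ N)) [SFinite ν] (β : ℝ) :
    therm (μ.prod ν) β Set.univ = ENNReal.ofReal (Bconst N β)⁻¹ *
      ∫⁻ y, ∫⁻ z, ENNReal.ofReal (Real.exp (-β * ‖y - z‖ ^ 2)) ∂ν ∂μ := by
  have hmeas : Measurable fun q : ZZ N × ZZ N =>
      ENNReal.ofReal (Real.exp (-β * ‖q.1 - q.2‖ ^ 2)) := by fun_prop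
  rw [therm, withDensity_apply _ MeasurableSet.univ, Measure.restrict_univ]
  simp_rw [ENNReal.ofReal_mul' (Real.exp_nonneg _)]
  rw [lintegral_const_mul _ hmeas, lintegral_prod _ hmeas.aemeasurable]

/-- On a cell of finite measure with second moment about `p` at most `ε²` times its mass, the mass
times a Gaussian integral centred at `p` is controlled by the wider Gaussian averaged over the
cell. -/
theorem measure_mul_lintegral_exp_le {V : Type*} [NormedAddCommGroup V] [MeasurableSpace V]
    [BorelSpace V] [SecondCountableTopology V] {μ ν : Measure V} [IsFiniteMeasure μ] [SFinite ν]
    {p : V} {ε β : ℝ} (hβ : 0 ≤ β)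
    (hmom : ∫⁻ y, ENNReal.ofReal (‖y - p‖ ^ 2) ∂μ ≤ ENNReal.ofReal (ε ^ 2) * μ Set.univ) :
    μ Set.univ * ∫⁻ z, ENNReal.ofReal (Real.exp (-β * ‖p - z‖ ^ 2)) ∂ν ≤
      ENNReal.ofReal (Real.exp (β * ε ^ 2)) *
        ∫⁻ y, ∫⁻ z, ENNReal.ofReal (Real.exp (-(β / 2) * ‖y - z‖ ^ 2)) ∂ν ∂μ := by
  set F := ∫⁻ z, ENNReal.ofReal (Real.exp (-β * ‖p - z‖ ^ 2)) ∂ν with hF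
  have hmass : ENNReal.ofReal (Real.exp (-(β * ε ^ 2))) * μ Set.univ ≤
      ∫⁻ y, ENNReal.ofReal (Real.exp (-(β * ‖y - p‖ ^ 2))) ∂μ := by
    refine exp_neg_mul_measure_univ_le_lintegral (by fun_prop) (fun y => by positivity)
      (by positivity) ?_
    simp_rw [ENNReal.ofReal_mul hβ]
    rw [lintegral_const_mul _ (by fun_prop), mul_assoc]
    gcongr
  have hinner : ∀ y, ENNReal.ofReal (Real.exp (-(β * ‖y - p‖ ^ 2))) * F ≤
      ∫⁻ z, ENNReal.ofReal (Real.exp (-(β / 2) * ‖y - z‖ ^ 2)) ∂ν := by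
    intro y
    rw [hF, ← lintegral_const_mul _ (by fun_prop)]
    refine lintegral_mono fun z => ?_
    rw [← ENNReal.ofReal_mul (Real.exp_nonneg _)]
    exact ENNReal.ofReal_le_ofReal (exp_neg_mul_exp_neg_le hβ y p z)
  calc μ Set.univ * F
      = ENNReal.ofReal (Real.exp (β * ε ^ 2)) *
          (ENNReal.ofReal (Real.exp (-(β * ε ^ 2))) * μ Set.univ * F) := by
        rw [← mul_assoc, ← mul_assoc, ← ENNReal.ofReal_mul (Real.exp_nonneg _), ← Real.exp_add,
          add_neg_cancel, Real.exp_zero, ENNReal.ofReal_one, one_mul]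
    _ ≤ ENNReal.ofReal (Real.exp (β * ε ^ 2)) *
          ((∫⁻ y, ENNReal.ofReal (Real.exp (-(β * ‖y - p‖ ^ 2))) ∂μ) * F) := by gcongr
    _ = ENNReal.ofReal (Real.exp (β * ε ^ 2)) *
          ∫⁻ y, ENNReal.ofReal (Real.exp (-(β * ‖y - p‖ ^ 2))) * F ∂μ := by
        rw [lintegral_mul_const _ (by fun_prop)]
    _ ≤ _ := by
        gcongr with y
        exact hinner y

/-!
STATEMENT 11: total variation bound for thermalized discrete approximations.
With `μ_disc := (Σ_{p∈P} m_p δ_p) × H^N⌞E` built from a countable Borel partition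
`{A_p}` with `p ∈ A_p`, `μ_D(A_p) < ∞`, weights `m_p ≤ c̄ μ_D(A_p)` and
second moments `∫_{A_p} ‖y − p‖² dμ_D ≤ ε² μ_D(A_p)`, for every `β > 0`,
`‖(μ_disc)_β‖_TV ≤ c̄ e^{βε²} 2^N ‖μ_{β/2}‖_TV`, where `μ = μ_D × H^N⌞E`.
-/

theorem discrete_thermalization_TV_bound
    (N : ℕ) (μD : Measure (ZZ N))
    (E : AffineSubspace ℝ (ZZ N)) (hE : (E : Set (ZZ N)).Nonempty)
    (hdim : Module.finrank ℝ E.direction = N)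
    {ι : Type} [Countable ι]
    (p : ι → ZZ N) (A : ι → Set (ZZ N))
    (hAmeas : ∀ i, MeasurableSet (A i))
    (hdisj : Pairwise fun i j => Disjoint (A i) (A j))
    (hcover : (⋃ i, A i) = Set.univ)
    (hpA : ∀ i, p i ∈ A i)
    (hAfin : ∀ i, μD (A i) < ⊤)
    (m : ι → ENNReal) (cbar : ℝ) (hcbar : 0 < cbar)
    (hm : ∀ i, m i ≤ ENNReal.ofReal cbar * μD (A i))
    (ε : ℝ) (hε : 0 < ε)
    (hmom : ∀ i, ∫⁻ y in A i, ENNReal.ofReal (‖y - p i‖ ^ 2) ∂μD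
      ≤ ENNReal.ofReal (ε ^ 2) * μD (A i))
    (β : ℝ) (hβ : 0 < β) :
    (therm ((Measure.sum fun i => m i • Measure.dirac (p i)).prod (muE N E)) β) Set.univ
      ≤ ENNReal.ofReal (cbar * Real.exp (β * ε ^ 2) * 2 ^ N) *
        (therm (μD.prod (muE N E)) (β / 2)) Set.univ := by
  have hsigma := sigmaFinite_muE hE hdim
  have hB : (0 : ℝ) ≤ (Bconst N (β / 2))⁻¹ := by
    rw [Bconst_eq N (half_pos hβ)]
    positivity
  have hcell : ∀ i, m i * ∫⁻ z, ENNReal.ofReal (Real.exp (-β * ‖p i - z‖ ^ 2)) ∂muE N E ≤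
      ENNReal.ofReal (cbar * Real.exp (β * ε ^ 2)) * ∫⁻ y in A i,
        ∫⁻ z, ENNReal.ofReal (Real.exp (-(β / 2) * ‖y - z‖ ^ 2)) ∂muE N E ∂μD := by
    intro i
    have : IsFiniteMeasure (μD.restrict (A i)) := isFiniteMeasure_restrict.mpr (hAfin i).ne
    have hcore := measure_mul_lintegral_exp_le (μ := μD.restrict (A i)) (ν := muE N E)
      (p := p i) (ε := ε) hβ.le (by rw [Measure.restrict_apply_univ]; exact hmom i)
    rw [Measure.restrict_apply_univ] at hcore
    rw [ENNReal.ofReal_mul hcbar.le, mul_assoc]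
    refine (mul_le_mul_left (hm i) _).trans ?_
    rw [mul_assoc]
    exact mul_le_mul_right hcore _
  have hmeas : Measurable fun y : ZZ N =>
      ∫⁻ z, ENNReal.ofReal (Real.exp (-β * ‖y - z‖ ^ 2)) ∂muE N E :=
    Measurable.lintegral_prod_right' (f := fun q : ZZ N × ZZ N =>
      ENNReal.ofReal (Real.exp (-β * ‖q.1 - q.2‖ ^ 2))) (by fun_prop)
  rw [therm_prod_univ, therm_prod_univ, lintegral_sum_measure,
    inv_Bconst_eq_two_pow_mul N hβ, ← setLIntegral_univ (μ := μD), ← hcover,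
    lintegral_iUnion hAmeas hdisj]
  simp_rw [lintegral_smul_measure, lintegral_dirac' _ hmeas, smul_eq_mul]
  refine (mul_le_mul_right (ENNReal.tsum_le_tsum hcell) _).trans_eq ?_
  rw [ENNReal.tsum_mul_left, ← mul_assoc, ← mul_assoc, ENNReal.ofReal_mul (by positivity),
    ENNReal.ofReal_mul (p := cbar * Real.exp (β * ε ^ 2)) (by positivity)]
  ring
end
end
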